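/- arXiv:1304.0566 — 2 statements merged into one kernel-verified Lean document; each statement's English description precedes it below -/
import Mathlib

section
/- Let X be a rooted tree in which every vertex has at least one and at most K children, equipped with the uniformizing metric d_X with parameter ε > 0 and the measure μ with parameter β > log K. Let x ∈ X, 0 < r ≤ 2·diam X, and set R₀ = e^{-ε|x|}/ε. If |x| ≤ (log 2)/ε then μ(B(x,r)) ≃ r. If |x| ≥ (log 2)/ε then μ(B(x,r)) ≃ e^{(ε-β)|x|} r for r ≤ R₀ and μ(B(x,r)) ≃ r^{β/ε} for r ≥ R₀. All comparison constants depend only on K, ε and β. -/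
open MeasureTheory Set
open scoped ENNReal

/-- A rooted (metric) tree in which every vertex has at least one and at most `K`
children, equipped with the uniformizing metric with parameter `ε`
(`d_X(x,y) = ∫_{[x,y]} e^{-ε|z|} d|z|`, encoded in the definition `UnifTree.d` below) and
the weighted measure `dμ(x) = e^{-β|x|} d|x|` (encoded by the axiom `μ_seg`).

The carrier `X` consists of all points of the metric graph (vertices and edge points);
`h x` is the distance `|x|` to the root in the unweighted (graph) metric, `le x y` means
that `x` lies on the geodesic from the root to `y`, `meet x y` is the largest common
ancestor of `x` and `y`, and `down x t` is the unique point below `x` at level `t`. -/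
structure UnifTree (K : ℕ) (ε β : ℝ) where
  X : Type
  mX : MeasurableSpace X
  μ : @MeasureTheory.Measure X mX
  le : X → X → Prop
  root : X
  h : X → ℝ
  isVertex : X → Prop
  meet : X → X → X
  down : X → ℝ → X
  -- `le` is a partial order with the root as least element, any two ancestors of a
  -- point being comparable
  le_refl : ∀ x, le x x
  le_trans : ∀ x y z, le x y → le y z → le x z
  le_antisymm : ∀ x y, le x y → le y x → x = y
  le_total_below : ∀ x y z, le x z → le y z → (le x y ∨ le y x)
  root_le : ∀ x, le root x
  -- `h` is the level function (graph distance to the root)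
  h_root : h root = 0
  h_nonneg : ∀ x, 0 ≤ h x
  h_mono : ∀ x y, le x y → h x ≤ h y
  h_strict : ∀ x y, le x y → h x = h y → x = y
  -- `meet` is the largest common ancestor
  meet_le_left : ∀ x y, le (meet x y) x
  meet_le_right : ∀ x y, le (meet x y) y
  meet_greatest : ∀ x y z, le z x → le z y → le z (meet x y)
  -- each point has a unique ancestor at every level `t ∈ [0, h x]`
  down_le : ∀ x t, 0 ≤ t → t ≤ h x → le (down x t) x
  h_down : ∀ x t, 0 ≤ t → t ≤ h x → h (down x t) = t
  down_eq : ∀ x y, le y x → down x (h y) = y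
  -- vertices sit exactly at the integer levels
  vertex_level : ∀ x, isVertex x → ∃ n : ℕ, h x = n
  level_vertex : ∀ x (n : ℕ), (n : ℝ) ≤ h x → isVertex (down x n)
  root_vertex : isVertex root
  -- every vertex has at least one and at most `K` children
  children_atLeastOne : ∀ x, isVertex x → ∃ y, isVertex y ∧ le x y ∧ h y = h x + 1
  children_finite : ∀ x, isVertex x → {y | isVertex y ∧ le x y ∧ h y = h x + 1}.Finite
  children_atMostK : ∀ x, isVertex x → {y | isVertex y ∧ le x y ∧ h y = h x + 1}.ncard ≤ K
  -- every point lies on an edge below some vertex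
  on_edge : ∀ x, ∃ v, isVertex v ∧ le x v ∧ h v ≤ h x + 1
  -- the measure `μ` is given by `dμ(x) = e^{-β|x|} d|x|`: on each piece of a branch it
  -- is the weighted length measure
  μ_seg : ∀ x a b, 0 ≤ a → a ≤ b → b ≤ h x →
    μ {y | le y x ∧ a ≤ h y ∧ h y ≤ b} = ENNReal.ofReal (∫ t in a..b, Real.exp (-β * t))

attribute [instance] UnifTree.mX

namespace UnifTree

variable {K : ℕ} {ε β : ℝ}

/-- The uniformizing metric `d_X(x,y) = ∫_{[x,y]} e^{-ε|z|} d|z|`: integrating the weight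
`e^{-ε t}` along the geodesic from `x` to `y`, which passes through `meet x y`. -/
noncomputable def d (T : UnifTree K ε β) (x y : T.X) : ℝ :=
  (Real.exp (-ε * T.h (T.meet x y)) - Real.exp (-ε * T.h x)) / ε +
    (Real.exp (-ε * T.h (T.meet x y)) - Real.exp (-ε * T.h y)) / ε

/-- The open ball with respect to the uniformizing metric. -/
def ball (T : UnifTree K ε β) (x : T.X) (r : ℝ) : Set T.X := {y | T.d x y < r}

/-- The downward directed half ball `F(x,r) = {y ∈ X : y ≥ x and d_X(x,y) < r}`. -/
def halfBall (T : UnifTree K ε β) (x : T.X) (r : ℝ) : Set T.X :=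
  {y | T.le x y ∧ T.d x y < r}

/-- The diameter of `X` in the uniformizing metric. -/
noncomputable def diam (T : UnifTree K ε β) : ℝ :=
  sSup {s : ℝ | ∃ x y : T.X, s = T.d x y}

end UnifTree

namespace UnifTree

variable {K : ℕ} {ε β : ℝ}

section Order

variable (T : UnifTree K ε β)

lemma le_of_h_le {x y z : T.X} (hx : T.le x z) (hy : T.le y z) (hxy : T.h x ≤ T.h y) :
    T.le x y := by
  rcases T.le_total_below x y z hx hy with h | h
  · exact h
  · rw [T.h_strict y x h (_root_.le_antisymm (T.h_mono y x h) hxy)]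
    exact T.le_refl x

lemma meet_eq_left {x y : T.X} (hxy : T.le x y) : T.meet x y = x :=
  T.le_antisymm _ _ (T.meet_le_left x y) (T.meet_greatest x y x (T.le_refl x) hxy)

lemma meet_eq_right {x y : T.X} (hyx : T.le y x) : T.meet x y = y :=
  T.le_antisymm _ _ (T.meet_le_right x y) (T.meet_greatest x y y hyx (T.le_refl y))

lemma exists_ge_h_ge (x : T.X) (n : ℕ) : ∃ w, T.isVertex w ∧ T.le x w ∧ (n : ℝ) ≤ T.h w := by
  induction n with
  | zero =>
    obtain ⟨v, hv, hxv, -⟩ := T.on_edge x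
    exact ⟨v, hv, hxv, by simpa using T.h_nonneg v⟩
  | succ n ih =>
    obtain ⟨w, hw, hxw, hn⟩ := ih
    obtain ⟨y, hy, hwy, hh⟩ := T.children_atLeastOne w hw
    exact ⟨y, hy, T.le_trans _ _ _ hxw hwy, by push_cast; linarith⟩

lemma exists_vertex_ge_at_level (x : T.X) (n : ℕ) (hn : T.h x ≤ n) :
    ∃ w, T.isVertex w ∧ T.le x w ∧ T.h w = n := by
  obtain ⟨w, -, hxw, hnw⟩ := T.exists_ge_h_ge x n
  have hd := T.h_down w n n.cast_nonneg hnw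
  exact ⟨T.down w n, T.level_vertex w n hnw,
    T.le_of_h_le hxw (T.down_le w n n.cast_nonneg hnw) (hn.trans_eq hd.symm), hd⟩

/-- The descendants of a vertex `j` generations below it number at most `K ^ j`. -/
lemma exists_finset_descendants (v : T.X) (hv : T.isVertex v) (j : ℕ) :
    ∃ F : Finset T.X, F.card ≤ K ^ j ∧ (∀ w ∈ F, T.isVertex w ∧ T.h w = T.h v + j) ∧
      ∀ w, T.isVertex w → T.le v w → T.h w = T.h v + j → w ∈ F := by
  classical
  induction j with
  | zero =>
    refine ⟨{v}, by simp, by simpa using hv, fun w _ hvw hh => ?_⟩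
    rw [T.h_strict v w hvw (by simpa using hh.symm)]
    simp
  | succ j ih =>
    obtain ⟨F, hF, hFv, hFm⟩ := ih
    obtain ⟨m, hm⟩ := T.vertex_level v hv
    let c : T.X → Finset T.X := fun u =>
      if hu : T.isVertex u then (T.children_finite u hu).toFinset else ∅
    refine ⟨F.biUnion c, ?_, ?_, ?_⟩
    · rw [pow_succ]
      refine (Finset.card_biUnion_le_card_mul _ _ K fun u hu => ?_).trans
        (Nat.mul_le_mul_right K hF)
      have hu' := (hFv u hu).1
      simp only [c, dif_pos hu']
      rw [← Set.ncard_eq_toFinset_card _ (T.children_finite u hu')]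
      exact T.children_atMostK u hu'
    · intro w hw
      obtain ⟨u, hu, hwu⟩ := Finset.mem_biUnion.1 hw
      simp only [c, dif_pos (hFv u hu).1, Set.Finite.mem_toFinset, mem_ofPred_eq] at hwu
      refine ⟨hwu.1, ?_⟩
      rw [hwu.2.2, (hFv u hu).2]
      push_cast
      ring
    · intro w hw hvw hh
      push_cast at hh
      have hle : ((m + j : ℕ) : ℝ) ≤ T.h w := by push_cast; linarith
      have hd := T.h_down w _ (Nat.cast_nonneg _) hle
      have hdw := T.down_le w _ (Nat.cast_nonneg _) hle
      have hdv := T.level_vertex w _ hle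
      push_cast at hd hdw hdv
      have hu := hFm _ hdv (T.le_of_h_le hvw hdw (by rw [hd, hm]; simp)) (by rw [hd, hm])
      refine Finset.mem_biUnion.2 ⟨_, hu, ?_⟩
      simp only [c, dif_pos hdv, Set.Finite.mem_toFinset, mem_ofPred_eq]
      exact ⟨hw, hdw, by rw [hd, hh, hm]; ring⟩

end Order

section Measure

lemma integral_exp_le (hβ : 0 ≤ β) {a b : ℝ} (hab : a ≤ b) :
    ∫ t in a..b, Real.exp (-β * t) ≤ Real.exp (-β * a) * (b - a) := by
  have h := intervalIntegral.integral_mono_on (μ := volume) hab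
    (f := fun t => Real.exp (-β * t)) (g := fun _ => Real.exp (-β * a))
    (Continuous.intervalIntegrable (by fun_prop) _ _) intervalIntegrable_const
    (fun t ht => Real.exp_le_exp.2 (by nlinarith [ht.1]))
  simpa [mul_comm] using h

lemma le_integral_exp (hβ : 0 ≤ β) {a b : ℝ} (hab : a ≤ b) :
    Real.exp (-β * b) * (b - a) ≤ ∫ t in a..b, Real.exp (-β * t) := by
  have h := intervalIntegral.integral_mono_on (μ := volume) hab
    (f := fun _ => Real.exp (-β * b)) (g := fun t => Real.exp (-β * t))
    intervalIntegrable_const (Continuous.intervalIntegrable (by fun_prop) _ _)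
    (fun t ht => Real.exp_le_exp.2 (by nlinarith [ht.2]))
  simpa [mul_comm] using h

variable (T : UnifTree K ε β)

lemma measure_band_le (hβ : 0 ≤ β) (v : T.X) (hv : T.isVertex v) (N : ℕ) {a b : ℝ} (ha : 0 ≤ a)
    (hab : a ≤ b) (hb : b ≤ T.h v + N) :
    T.μ {y | T.le v y ∧ a ≤ T.h y ∧ T.h y ≤ b} ≤
      ENNReal.ofReal ((K : ℝ) ^ N * (Real.exp (-β * a) * (b - a))) := by
  obtain ⟨F, hF, hFv, hFm⟩ := T.exists_finset_descendants v hv N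
  obtain ⟨m, hm⟩ := T.vertex_level v hv
  have hsub : {y | T.le v y ∧ a ≤ T.h y ∧ T.h y ≤ b} ⊆
      ⋃ w ∈ F, {y | T.le y w ∧ a ≤ T.h y ∧ T.h y ≤ b} := by
    rintro y ⟨hvy, hy⟩
    obtain ⟨w, hw, hyw, hwh⟩ := T.exists_vertex_ge_at_level y (m + N)
      (by push_cast; linarith [hy.2])
    push_cast at hwh
    exact mem_iUnion₂.2 ⟨w, hFm w hw (T.le_trans _ _ _ hvy hyw) (by rw [hwh, hm]), hyw, hy⟩
  have hnn : 0 ≤ Real.exp (-β * a) * (b - a) :=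
    mul_nonneg (Real.exp_nonneg _) (sub_nonneg.2 hab)
  calc _ ≤ ∑ w ∈ F, T.μ {y | T.le y w ∧ a ≤ T.h y ∧ T.h y ≤ b} :=
        (measure_mono hsub).trans (measure_biUnion_finset_le _ _)
    _ ≤ ∑ w ∈ F, ENNReal.ofReal (Real.exp (-β * a) * (b - a)) := by
        refine Finset.sum_le_sum fun w hw => ?_
        rw [T.μ_seg w a b ha hab (by rw [(hFv w hw).2]; exact hb)]
        exact ENNReal.ofReal_le_ofReal (integral_exp_le hβ hab)
    _ ≤ _ := by
        rw [Finset.sum_const, ← ENNReal.ofReal_nsmul, nsmul_eq_mul]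
        refine ENNReal.ofReal_le_ofReal (mul_le_mul_of_nonneg_right ?_ hnn)
        exact_mod_cast hF

/-- The integer-level ancestor of a point on the edge containing it. -/
lemma exists_vertex_le (p : T.X) :
    ∃ v, T.isVertex v ∧ T.le v p ∧ T.h v ≤ T.h p ∧ T.h p ≤ T.h v + 1 := by
  have h0 := T.h_nonneg p
  have hfl := Nat.floor_le h0
  have hd := T.h_down p _ (Nat.cast_nonneg _) hfl
  refine ⟨_, T.level_vertex p _ hfl, T.down_le p _ (Nat.cast_nonneg _) hfl, ?_, ?_⟩
  · rwa [hd]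
  · rw [hd]; exact (Nat.lt_floor_add_one _).le

lemma measure_descendants_le (hβ : 0 ≤ β) (hK : K * Real.exp (-β) < 1) (p : T.X) :
    T.μ {y | T.le p y} ≤ ENNReal.ofReal
      (K * Real.exp β * (1 - K * Real.exp (-β))⁻¹ * Real.exp (-β * T.h p)) := by
  obtain ⟨v, hv, hvp, hvh, hph⟩ := T.exists_vertex_le p
  have hv0 := T.h_nonneg v
  have hsub : {y | T.le p y} ⊆
      ⋃ j : ℕ, {y | T.le v y ∧ T.h v + j ≤ T.h y ∧ T.h y ≤ T.h v + (j + 1 : ℕ)} := by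
    intro y hy
    have hvy := T.le_trans _ _ _ hvp hy
    have hh := sub_nonneg.2 (T.h_mono _ _ hvy)
    refine mem_iUnion.2 ⟨⌊T.h y - T.h v⌋₊, hvy, ?_, ?_⟩
    · linarith [Nat.floor_le hh]
    · push_cast
      linarith [Nat.lt_floor_add_one (T.h y - T.h v)]
  have hq : 0 ≤ K * Real.exp (-β) := by positivity
  have hs : HasSum (fun j : ℕ => K * Real.exp (-β * T.h v) * (K * Real.exp (-β)) ^ j)
      (K * Real.exp (-β * T.h v) * (1 - K * Real.exp (-β))⁻¹) :=
    (hasSum_geometric_of_lt_one hq hK).mul_left _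
  calc _ ≤ ∑' j : ℕ, T.μ {y | T.le v y ∧ T.h v + j ≤ T.h y ∧ T.h y ≤ T.h v + (j + 1 : ℕ)} :=
        (measure_mono hsub).trans (measure_iUnion_le _)
    _ ≤ ∑' j : ℕ, ENNReal.ofReal (K * Real.exp (-β * T.h v) * (K * Real.exp (-β)) ^ j) := by
        refine ENNReal.tsum_le_tsum fun j => ?_
        refine (T.measure_band_le hβ v hv (j + 1) (by positivity) (by push_cast; linarith)
          le_rfl).trans (ENNReal.ofReal_le_ofReal (le_of_eq ?_))
        rw [mul_pow, ← Real.exp_nat_mul, mul_add, Real.exp_add]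
        push_cast
        ring_nf
    _ = ENNReal.ofReal (K * Real.exp (-β * T.h v) * (1 - K * Real.exp (-β))⁻¹) := by
        rw [← ENNReal.ofReal_tsum_of_nonneg (fun j => by positivity) hs.summable, hs.tsum_eq]
    _ ≤ _ := by
        refine ENNReal.ofReal_le_ofReal ?_
        have h1 : Real.exp (-β * T.h v) ≤ Real.exp β * Real.exp (-β * T.h p) := by
          rw [← Real.exp_add]
          exact Real.exp_le_exp.2 (by nlinarith)
        have h2 : 0 ≤ (1 - K * Real.exp (-β))⁻¹ := inv_nonneg.2 (by linarith)
        calc _ ≤ K * (Real.exp β * Real.exp (-β * T.h p)) * (1 - K * Real.exp (-β))⁻¹ := by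
              gcongr
          _ = _ := by ring

end Measure

section Ball

variable (T : UnifTree K ε β)

lemma d_le (hε : 0 < ε) (x y : T.X) : T.d x y ≤ 2 / ε := by
  unfold d
  rw [← add_div]
  have h1 : Real.exp (-ε * T.h (T.meet x y)) ≤ 1 :=
    Real.exp_le_one_iff.2 (by nlinarith [T.h_nonneg (T.meet x y)])
  gcongr
  linarith [Real.exp_pos (-ε * T.h x), Real.exp_pos (-ε * T.h y)]

lemma diam_le (hε : 0 < ε) : T.diam ≤ 2 / ε := by
  refine Real.sSup_le ?_ (by positivity)
  rintro s ⟨x, y, rfl⟩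
  exact T.d_le hε x y

lemma exp_sub_lt_of_mem_ball (hε : 0 < ε) {x y : T.X} {r : ℝ} (hy : y ∈ T.ball x r) :
    Real.exp (-ε * T.h (T.meet x y)) < Real.exp (-ε * T.h x) + ε * r ∧
      Real.exp (-ε * T.h x) - ε * r < Real.exp (-ε * T.h y) := by
  have hy' : T.d x y < r := hy
  unfold d at hy'
  rw [← add_div, div_lt_iff₀ hε] at hy'
  have h1 : Real.exp (-ε * T.h x) ≤ Real.exp (-ε * T.h (T.meet x y)) :=
    Real.exp_le_exp.2 (by nlinarith [T.h_mono _ _ (T.meet_le_left x y)])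
  have h2 : Real.exp (-ε * T.h y) ≤ Real.exp (-ε * T.h (T.meet x y)) :=
    Real.exp_le_exp.2 (by nlinarith [T.h_mono _ _ (T.meet_le_right x y)])
  constructor <;> linarith

/-- Every ball lies below one ancestor of its centre, whose level is controlled by the radius. -/
lemma exists_ancestor_ball (hε : 0 < ε) (x : T.X) {r : ℝ} (hr : 0 < r) :
    ∃ p, -Real.log (Real.exp (-ε * T.h x) + ε * r) / ε ≤ T.h p ∧
      Real.exp (-ε * T.h p) ≤ Real.exp (-ε * T.h x) + ε * r ∧ T.h p ≤ T.h x ∧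
      ∀ y ∈ T.ball x r, T.le p y := by
  set E := Real.exp (-ε * T.h x) with hE
  have hE0 : 0 < E := Real.exp_pos _
  have hs : 0 < E + ε * r := by positivity
  set a := max 0 (-Real.log (E + ε * r) / ε) with ha
  have ha0 : 0 ≤ a := le_max_left _ _
  have hax : a ≤ T.h x := by
    refine max_le (T.h_nonneg x) ?_
    rw [div_le_iff₀ hε]
    have : -ε * T.h x ≤ Real.log (E + ε * r) := by
      rw [Real.le_log_iff_exp_le hs]
      nlinarith
    linarith
  have hd := T.h_down x a ha0 hax
  refine ⟨T.down x a, by rw [hd]; exact le_max_right _ _, ?_, by rwa [hd], fun y hy => ?_⟩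
  · rw [hd, ← Real.le_log_iff_exp_le hs]
    have := le_max_right 0 (-Real.log (E + ε * r) / ε)
    rw [← ha, div_le_iff₀ hε] at this
    linarith
  · have hz := (T.exp_sub_lt_of_mem_ball hε hy).1
    refine T.le_trans _ _ _ (T.le_of_h_le (T.down_le x a ha0 hax) (T.meet_le_left x y) ?_)
      (T.meet_le_right x y)
    rw [hd]
    refine max_le (T.h_nonneg _) ?_
    rw [← Real.lt_log_iff_exp_lt hs] at hz
    rw [div_le_iff₀ hε]
    linarith

lemma exp_neg_mul_eq_rpow (hε : 0 < ε) (s : ℝ) :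
    Real.exp (-β * s) = Real.exp (-ε * s) ^ (β / ε) := by
  rw [← Real.exp_mul]
  congr 1
  field_simp

lemma exp_sub_mul_eq (s : ℝ) :
    Real.exp ((ε - β) * s) = Real.exp (-β * s) / Real.exp (-ε * s) := by
  rw [← Real.exp_sub]
  congr 1
  ring

lemma measure_ball_le_of_small (hε : 0 < ε) (hβ : 0 < β) : ∃ C : ℝ, 0 < C ∧
    ∀ (T : UnifTree K ε β) (x : T.X) (r : ℝ), 0 < r → 2 * (ε * r) ≤ Real.exp (-ε * T.h x) →
      T.μ (T.ball x r) ≤ ENNReal.ofReal (C * (Real.exp ((ε - β) * T.h x) * r)) := by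
  have hq : 0 < β / ε := by positivity
  set N := ⌈2 / ε⌉₊ + 1
  refine ⟨(K : ℝ) ^ N * 2 ^ (β / ε) * 4 + 1, by positivity, fun T x r hr hrE => ?_⟩
  obtain ⟨p, hp1, hp2, hpx, hp⟩ := T.exists_ancestor_ball hε x hr
  obtain ⟨v, hv, hvp, hvh, hph⟩ := T.exists_vertex_le p
  set E := Real.exp (-ε * T.h x) with hE
  have hE0 : 0 < E := Real.exp_pos _
  have hεr : 0 < ε * r := by positivity
  have hs : 0 < E + ε * r := by positivity
  have ht : 0 < E - ε * r := by linarith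
  set b := -Real.log (E - ε * r) / ε with hb
  have hbp : b - T.h p ≤ 4 * (r / E) := by
    have h1 : Real.log ((E + ε * r) / (E - ε * r)) ≤ (E + ε * r) / (E - ε * r) - 1 :=
      Real.log_le_sub_one_of_pos (by positivity)
    rw [Real.log_div hs.ne' ht.ne'] at h1
    have h2 : (E + ε * r) / (E - ε * r) - 1 ≤ 4 * (r / E) * ε := by
      rw [sub_le_iff_le_add, div_le_iff₀ ht]
      have : 4 * (r / E) * ε * E = 4 * (ε * r) := by field_simp
      have h3 : 4 * (r / E) * ε * (ε * r) ≤ 2 * (ε * r) := by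
        have : 4 * (r / E) * ε ≤ 2 := by
          rw [← mul_le_mul_iff_left₀ hE0, this]; linarith
        nlinarith
      nlinarith
    calc b - T.h p ≤ b - -Real.log (E + ε * r) / ε := by linarith
      _ = (Real.log (E + ε * r) - Real.log (E - ε * r)) / ε := by rw [hb]; ring
      _ ≤ 4 * (r / E) := by rw [div_le_iff₀ hε]; linarith
  have hxb : T.h x ≤ b := by
    rw [hb, le_div_iff₀ hε]
    have : Real.log (E - ε * r) ≤ Real.log E := Real.log_le_log ht (by linarith)
    rw [hE, Real.log_exp] at this
    rw [hE]
    linarith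
  have hrE' : 4 * (r / E) ≤ 2 / ε := by
    rw [le_div_iff₀ hε, ← mul_le_mul_iff_left₀ hE0]
    have : 4 * (r / E) * ε * E = 4 * (ε * r) := by field_simp
    linarith
  have hbN : b ≤ T.h v + N := by
    have := Nat.le_ceil (2 / ε)
    simp only [N]
    push_cast
    linarith
  have hsub : T.ball x r ⊆ {y | T.le v y ∧ T.h p ≤ T.h y ∧ T.h y ≤ b} := by
    intro y hy
    refine ⟨T.le_trans _ _ _ hvp (hp y hy), T.h_mono _ _ (hp y hy), ?_⟩
    have := (T.exp_sub_lt_of_mem_ball hε hy).2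
    rw [← hE, ← Real.log_lt_iff_lt_exp ht] at this
    rw [hb, le_div_iff₀ hε]
    linarith
  refine (measure_mono hsub).trans ((T.measure_band_le hβ.le v hv N (T.h_nonneg p)
    (hpx.trans hxb) hbN).trans (ENNReal.ofReal_le_ofReal ?_))
  have hpE : Real.exp (-β * T.h p) ≤ 2 ^ (β / ε) * Real.exp (-β * T.h x) := by
    rw [exp_neg_mul_eq_rpow hε, exp_neg_mul_eq_rpow hε (T.h x), ← hE,
      ← Real.mul_rpow (by norm_num) hE0.le]
    exact Real.rpow_le_rpow (Real.exp_nonneg _) (by linarith) hq.le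
  calc _ ≤ (K : ℝ) ^ N * ((2 ^ (β / ε) * Real.exp (-β * T.h x)) * (4 * (r / E))) := by
        gcongr
        linarith
    _ = (K : ℝ) ^ N * 2 ^ (β / ε) * 4 * (Real.exp ((ε - β) * T.h x) * r) := by
        rw [exp_sub_mul_eq, ← hE]
        ring
    _ ≤ _ := by
        gcongr
        linarith

lemma measure_ball_le_of_large (hε : 0 < ε) (hβ : 0 < β) (hK : K * Real.exp (-β) < 1) :
    ∃ C : ℝ, 0 < C ∧
    ∀ (T : UnifTree K ε β) (x : T.X) (r : ℝ), 0 < r → Real.exp (-ε * T.h x) ≤ 2 * (ε * r) →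
      T.μ (T.ball x r) ≤ ENNReal.ofReal (C * r ^ (β / ε)) := by
  have hq : 0 < β / ε := by positivity
  have hA : 0 ≤ K * Real.exp β * (1 - K * Real.exp (-β))⁻¹ :=
    mul_nonneg (by positivity) (inv_nonneg.2 (by linarith))
  set A := K * Real.exp β * (1 - K * Real.exp (-β))⁻¹
  refine ⟨A * (3 * ε) ^ (β / ε) + 1, by positivity, fun T x r hr hrE => ?_⟩
  obtain ⟨p, -, hp2, -, hp⟩ := T.exists_ancestor_ball hε x hr
  refine (measure_mono hp).trans ((T.measure_descendants_le hβ.le hK p).trans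
    (ENNReal.ofReal_le_ofReal ?_))
  calc A * Real.exp (-β * T.h p) ≤ A * ((3 * ε) ^ (β / ε) * r ^ (β / ε)) := by
        rw [exp_neg_mul_eq_rpow hε, ← Real.mul_rpow (by positivity) hr.le]
        gcongr
        linarith
    _ ≤ _ := by
        rw [← mul_assoc]
        gcongr
        linarith

lemma le_measure_ball_of_small (hε : 0 < ε) (hβ : 0 < β) : ∃ c : ℝ, 0 < c ∧
    ∀ (T : UnifTree K ε β) (x : T.X) (r : ℝ), 0 < r → ε * r ≤ 8 * Real.exp (-ε * T.h x) →
      ENNReal.ofReal (c * (Real.exp ((ε - β) * T.h x) * r)) ≤ T.μ (T.ball x r) := by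
  refine ⟨Real.exp (-β * (4 / ε)) / 2, by positivity, fun T x r hr hrE => ?_⟩
  set E := Real.exp (-ε * T.h x) with hE
  have hE0 : 0 < E := Real.exp_pos _
  set t := r / E / 2 with ht
  have ht0 : 0 < t := by positivity
  have htE : E * t = r / 2 := by rw [ht]; field_simp
  have ht4 : t ≤ 4 / ε := by
    rw [le_div_iff₀ hε, ← mul_le_mul_iff_right₀ hE0]
    nlinarith
  obtain ⟨w, -, hxw, hw⟩ := T.exists_ge_h_ge x ⌈T.h x + t⌉₊
  have hw' := (Nat.le_ceil _).trans hw
  have hsub : {y | T.le y w ∧ T.h x ≤ T.h y ∧ T.h y ≤ T.h x + t} ⊆ T.ball x r := by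
    rintro y ⟨hyw, h1, h2⟩
    have hxy := T.le_of_h_le hxw hyw h1
    have h3 : E * (1 - ε * t) ≤ Real.exp (-ε * T.h y) := by
      calc E * (1 - ε * t) ≤ E * Real.exp (-ε * t) := by
            gcongr
            linarith [Real.add_one_le_exp (-ε * t)]
        _ = Real.exp (-ε * (T.h x + t)) := by rw [mul_add, Real.exp_add]
        _ ≤ _ := Real.exp_le_exp.2 (by nlinarith)
    change T.d x y < r
    unfold d
    rw [T.meet_eq_left hxy, ← hE, ← add_div, div_lt_iff₀ hε]
    nlinarith
  refine _root_.le_trans ?_ (measure_mono hsub)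
  rw [T.μ_seg w _ _ (T.h_nonneg x) (by linarith) hw']
  refine ENNReal.ofReal_le_ofReal (_root_.le_trans ?_ (le_integral_exp hβ.le (by linarith)))
  calc _ = Real.exp (-β * (4 / ε)) * Real.exp (-β * T.h x) * t := by
        rw [exp_sub_mul_eq, ← hE, ht]
        ring
    _ ≤ Real.exp (-β * t) * Real.exp (-β * T.h x) * t := by
        gcongr ?_ * _ * _
        exact Real.exp_le_exp.2 (by nlinarith)
    _ = _ := by
        rw [← Real.exp_add]
        ring_nf

lemma le_measure_ball_of_large (hε : 0 < ε) (hβ : 0 < β) : ∃ c : ℝ, 0 < c ∧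
    ∀ (T : UnifTree K ε β) (x : T.X) (r : ℝ), 0 < r → Real.exp (-ε * T.h x) ≤ ε * r →
      ε * r ≤ 4 → ENNReal.ofReal (c * r ^ (β / ε)) ≤ T.μ (T.ball x r) := by
  obtain ⟨c, hc, hsmall⟩ := le_measure_ball_of_small (K := K) hε hβ
  have hq : 0 < β / ε := by positivity
  have hl : 0 < Real.log 2 / ε := div_pos (Real.log_pos one_lt_two) hε
  set l := Real.log 2 / ε with hldef
  set c₁ := c * (ε / 8) ^ (β / ε) / ε with hc₁
  set c₂ := (ε / 4) ^ (β / ε) * Real.exp (-β * l) * l with hc₂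
  refine ⟨min c₁ c₂, lt_min (by positivity) (by positivity), fun T x r hr hrE hr4 => ?_⟩
  rcases le_total (ε * r) (8 * Real.exp (-ε * T.h x)) with h8 | h8
  · refine _root_.le_trans (ENNReal.ofReal_le_ofReal ?_) (hsmall T x r hr h8)
    have hE0 := Real.exp_pos (-ε * T.h x)
    calc _ ≤ c₁ * r ^ (β / ε) := by gcongr; exact min_le_left _ _
      _ = c * ((ε / 8 * r) ^ (β / ε) * (1 / ε)) := by
          rw [Real.mul_rpow (by positivity) hr.le, hc₁]
          ring
      _ ≤ c * (Real.exp (-ε * T.h x) ^ (β / ε) * (r / Real.exp (-ε * T.h x))) := by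
          gcongr ?_ * (?_ ^ _ * ?_)
          · linarith
          · rw [div_le_div_iff₀ hε hE0]
            linarith
      _ = _ := by
          rw [exp_sub_mul_eq, exp_neg_mul_eq_rpow (β := β) hε]
          ring
  · have hr0 : 0 < ε / 4 * r := by positivity
    set a := -Real.log (ε / 4 * r) / ε with ha
    have hea : Real.exp (-ε * a) = ε / 4 * r := by
      rw [ha, show -ε * (-Real.log (ε / 4 * r) / ε) = Real.log (ε / 4 * r) by field_simp,
        Real.exp_log hr0]
    have ha0 : 0 ≤ a := by
      refine div_nonneg (neg_nonneg.2 (Real.log_nonpos hr0.le (by linarith))) hε.le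
    have hax : a + l ≤ T.h x := by
      have h1 : Real.exp (-ε * T.h x) ≤ Real.exp (-ε * (a + l)) := by
        rw [mul_add, Real.exp_add, hea, show -ε * l = -Real.log 2 by rw [hldef]; field_simp,
          Real.exp_neg, Real.exp_log two_pos]
        linarith
      have h2 := Real.exp_le_exp.1 h1
      nlinarith
    have hsub : {y | T.le y x ∧ a ≤ T.h y ∧ T.h y ≤ a + l} ⊆ T.ball x r := by
      rintro y ⟨hyx, h1, -⟩
      have h3 : Real.exp (-ε * T.h y) ≤ Real.exp (-ε * a) := Real.exp_le_exp.2 (by nlinarith)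
      rw [hea] at h3
      change T.d x y < r
      unfold d
      rw [T.meet_eq_right hyx, ← add_div, div_lt_iff₀ hε]
      nlinarith [Real.exp_pos (-ε * T.h x)]
    refine _root_.le_trans ?_ (measure_mono hsub)
    rw [T.μ_seg x _ _ ha0 (by linarith) hax]
    refine ENNReal.ofReal_le_ofReal (_root_.le_trans ?_ (le_integral_exp hβ.le (by linarith)))
    calc _ ≤ c₂ * r ^ (β / ε) := by gcongr; exact min_le_right _ _
      _ = (ε / 4 * r) ^ (β / ε) * Real.exp (-β * l) * l := by
          rw [Real.mul_rpow (by positivity) hr.le, hc₂]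
          ring
      _ = _ := by
          rw [← hea, ← exp_neg_mul_eq_rpow hε, ← Real.exp_add]
          ring_nf

end Ball

end UnifTree

/-- for a rooted tree whose vertices have at least one and at most K
children, with the uniformizing metric of parameter ε > 0 and the measure of parameter
β > log K: for `x ∈ X`, `0 < r ≤ 2·diam X` and `R₀ = e^{-ε|x|}/ε`, one has
`μ(B(x,r)) ≃ r` if `|x| ≤ (log 2)/ε`, while if `|x| ≥ (log 2)/ε` then
`μ(B(x,r)) ≃ e^{(ε-β)|x|} r` for `r ≤ R₀` and `μ(B(x,r)) ≃ r^{β/ε}` for `r ≥ R₀`.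
All comparison constants depend only on K, ε, β. -/
theorem statement3 (K : ℕ) (ε β : ℝ) (hε : 0 < ε) (hβ : Real.log K < β) :
    ∃ C : ℝ, 0 < C ∧ ∀ (T : UnifTree K ε β) (x : T.X) (r : ℝ),
      0 < r → r ≤ 2 * T.diam →
        (T.h x ≤ Real.log 2 / ε →
          ENNReal.ofReal (C⁻¹ * r) ≤ T.μ (T.ball x r) ∧
            T.μ (T.ball x r) ≤ ENNReal.ofReal (C * r)) ∧
        (Real.log 2 / ε ≤ T.h x →
          (r ≤ Real.exp (-ε * T.h x) / ε →
            ENNReal.ofReal (C⁻¹ * (Real.exp ((ε - β) * T.h x) * r)) ≤ T.μ (T.ball x r) ∧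
              T.μ (T.ball x r) ≤
                ENNReal.ofReal (C * (Real.exp ((ε - β) * T.h x) * r))) ∧
          (Real.exp (-ε * T.h x) / ε ≤ r →
            ENNReal.ofReal (C⁻¹ * r ^ (β / ε)) ≤ T.μ (T.ball x r) ∧
              T.μ (T.ball x r) ≤ ENNReal.ofReal (C * r ^ (β / ε)))) := by
  have hβ0 : 0 < β := (Real.log_natCast_nonneg K).trans_lt hβ
  have hK : K * Real.exp (-β) < 1 := by
    rw [Real.exp_neg, ← div_eq_mul_inv, div_lt_one (Real.exp_pos _)]
    rcases K.eq_zero_or_pos with rfl | hK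
    · simpa using Real.exp_pos β
    · exact (Real.log_lt_iff_lt_exp (by exact_mod_cast hK)).1 hβ
  have hq : 0 < β / ε := by positivity
  obtain ⟨A, hA, hupS⟩ := UnifTree.measure_ball_le_of_small (K := K) hε hβ0
  obtain ⟨B, hB, hupL⟩ := UnifTree.measure_ball_le_of_large hε hβ0 hK
  obtain ⟨a, ha, hloS⟩ := UnifTree.le_measure_ball_of_small (K := K) hε hβ0
  obtain ⟨b, hb, hloL⟩ := UnifTree.le_measure_ball_of_large (K := K) hε hβ0
  set G := Real.exp (|ε - β| * (Real.log 2 / ε)) with hG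
  have hG0 : 0 < G := Real.exp_pos _
  set D := B * (4 / ε) ^ (β / ε) * (4 * ε) with hD
  set D' := B * (1 / ε) ^ (β / ε) * (2 * ε) with hD'
  have hD0 : 0 < D := by positivity
  have hD'0 : 0 < D' := by positivity
  set C := A + B + a⁻¹ + b⁻¹ + A * G + G / a + D + D' with hC
  have hAG : 0 < A * G := by positivity
  have hGa : 0 < G / a := by positivity
  have hai : 0 < a⁻¹ := by positivity
  have hbi : 0 < b⁻¹ := by positivity
  have hC0 : 0 < C := by positivity
  have hCa : C⁻¹ ≤ a := inv_le_of_inv_le₀ ha (by linarith)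
  have hCb : C⁻¹ ≤ b := inv_le_of_inv_le₀ hb (by linarith)
  have hCG : C⁻¹ ≤ a * G⁻¹ := by
    refine inv_le_of_inv_le₀ (by positivity) ?_
    rw [mul_inv, inv_inv, mul_comm, ← div_eq_mul_inv]
    linarith
  refine ⟨C, hC0, fun T x r hr hrd => ?_⟩
  have hr4 : ε * r ≤ 4 := by
    have h1 : r ≤ 4 / ε := hrd.trans (by linarith [T.diam_le hε, show 4 / ε = 2 * (2 / ε) by ring])
    rw [le_div_iff₀ hε] at h1
    linarith
  set E := Real.exp (-ε * T.h x) with hE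
  have hE0 : 0 < E := Real.exp_pos _
  set g := Real.exp ((ε - β) * T.h x) with hg
  have hg0 : 0 < g := Real.exp_pos _
  refine ⟨fun hx => ?_, fun hx => ⟨fun hrE => ?_, fun hrE => ?_⟩⟩
  · have hE2 : 1 / 2 ≤ E := by
      rw [le_div_iff₀ hε] at hx
      rw [one_div, ← Real.exp_log two_pos, ← Real.exp_neg]
      exact Real.exp_le_exp.2 (by linarith)
    have habs : |(ε - β) * T.h x| ≤ |ε - β| * (Real.log 2 / ε) := by
      rw [abs_mul, abs_of_nonneg (T.h_nonneg x)]
      gcongr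
    have hgG : g ≤ G := Real.exp_le_exp.2 ((le_abs_self _).trans habs)
    have hGg : G⁻¹ ≤ g := by
      rw [hG, ← Real.exp_neg]
      exact Real.exp_le_exp.2 (by linarith [neg_abs_le ((ε - β) * T.h x)])
    constructor
    · refine le_trans (ENNReal.ofReal_le_ofReal ?_) (hloS T x r hr (by linarith))
      calc C⁻¹ * r ≤ a * G⁻¹ * r := by gcongr
        _ ≤ a * g * r := by gcongr
        _ = _ := by ring
    · rcases le_total (2 * (ε * r)) E with h | h
      · refine (hupS T x r hr h).trans (ENNReal.ofReal_le_ofReal ?_)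
        calc A * (g * r) ≤ A * (G * r) := by gcongr
          _ = A * G * r := by ring
          _ ≤ C * r := by gcongr; linarith
      · refine (hupL T x r hr h).trans (ENNReal.ofReal_le_ofReal ?_)
        calc B * r ^ (β / ε) ≤ B * (4 / ε) ^ (β / ε) := by
              gcongr
              rw [le_div_iff₀ hε]
              linarith
          _ ≤ B * (4 / ε) ^ (β / ε) * (4 * ε * r) :=
              le_mul_of_one_le_right (by positivity) (by linarith)
          _ = D * r := by rw [hD]; ring
          _ ≤ C * r := by gcongr; linarith
  · rw [le_div_iff₀ hε] at hrE
    constructor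
    · refine le_trans (ENNReal.ofReal_le_ofReal ?_) (hloS T x r hr (by linarith))
      gcongr
    · rcases le_total (2 * (ε * r)) E with h | h
      · refine (hupS T x r hr h).trans (ENNReal.ofReal_le_ofReal ?_)
        gcongr
        linarith
      · refine (hupL T x r hr h).trans (ENNReal.ofReal_le_ofReal ?_)
        calc B * r ^ (β / ε) ≤ B * (1 / ε * E) ^ (β / ε) := by
              gcongr
              rw [one_div_mul_eq_div, le_div_iff₀ hε]
              exact hrE
          _ = B * (1 / ε) ^ (β / ε) * E ^ (β / ε) * 1 := by
              rw [Real.mul_rpow (by positivity) hE0.le]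
              ring
          _ ≤ B * (1 / ε) ^ (β / ε) * E ^ (β / ε) * (2 * (ε * r) / E) := by
              gcongr
              rwa [one_le_div hE0]
          _ = D' * (g * r) := by
              rw [hg, UnifTree.exp_sub_mul_eq, UnifTree.exp_neg_mul_eq_rpow hε, hD', ← hE]
              ring
          _ ≤ C * (g * r) := by gcongr; linarith
  · rw [div_le_iff₀ hε] at hrE
    constructor
    · refine le_trans (ENNReal.ofReal_le_ofReal ?_) (hloL T x r hr (by linarith) hr4)
      gcongr
    · refine (hupL T x r hr (by nlinarith)).trans (ENNReal.ofReal_le_ofReal ?_)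
      gcongr
      linarith
end

section
/- Let X and Y be rooted trees such that each vertex has at least two children, with roots 0_X and 0_Y. Assume G : X → Y is a map between the vertex sets satisfying: (i) G is injective; (ii) G maps geodesics into geodesics, i.e. the image of every bi-infinite geodesic line in X is contained in a geodesic line in Y; (iii) for each vertex y ∈ Y there is a vertex x ∈ X such that G(x) > y (G(x) is a strict descendant of y); (iv) G(0_X) = 0_Y or 0_Y has at least three children. Then G is an isometry with respect to the graph distances: |G(x) - G(y)| = |x - y| for all vertices x, y ∈ X, and G is surjective. -/
open Set

/-- A rooted tree, described combinatorially by its vertex set, its root, the parent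
function and the depth (graph distance to the root). Every vertex `v` is connected to
the root by the chain of its iterated parents. -/
structure VTree where
  V : Type
  root : V
  parent : V → V
  depth : V → ℕ
  parent_root : parent root = root
  depth_root : depth root = 0
  depth_parent : ∀ v, v ≠ root → depth v = depth (parent v) + 1
  parent_iter_root : ∀ v, parent^[depth v] v = root

namespace VTree

/-- The ancestor of `v` at depth `n` (for `n ≤ depth v`). -/
def anc (T : VTree) (v : T.V) (n : ℕ) : T.V := T.parent^[T.depth v - n] v

/-- `T.le x y` means that `x` is an ancestor of `y` (the geodesic from the root to `y`
passes through `x`). -/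
def le (T : VTree) (x y : T.V) : Prop := T.depth x ≤ T.depth y ∧ T.anc y (T.depth x) = x

/-- The depth of the largest common ancestor of `x` and `y`. -/
noncomputable def meetDepth (T : VTree) (x y : T.V) : ℕ :=
  sSup {n | n ≤ min (T.depth x) (T.depth y) ∧ T.anc x n = T.anc y n}

/-- The graph distance between two vertices: the number of edges in the geodesic. -/
noncomputable def vdist (T : VTree) (x y : T.V) : ℕ :=
  (T.depth x - T.meetDepth x y) + (T.depth y - T.meetDepth x y)

/-- Every vertex has at least two children. -/
def TwoChildren (T : VTree) : Prop :=
  ∀ v : T.V, ∃ w₁ w₂ : T.V, w₁ ≠ w₂ ∧ w₁ ≠ T.root ∧ w₂ ≠ T.root ∧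
    T.parent w₁ = v ∧ T.parent w₂ = v

/-- `y < x`: `x` is a strict descendant of `y`. -/
def strictDesc (T : VTree) (y x : T.V) : Prop :=
  T.depth y < T.depth x ∧ T.anc x (T.depth y) = y

/-- A geodesic line in a tree: a bi-infinite injective path (consecutive vertices are
joined by edges, i.e. are in the parent-child relation). -/
def IsGeodLine (T : VTree) (γ : ℤ → T.V) : Prop :=
  Function.Injective γ ∧
    ∀ n : ℤ, T.parent (γ n) = γ (n + 1) ∨ T.parent (γ (n + 1)) = γ n

end VTree

namespace VTree

variable (T : VTree)

lemma depth_parent_eq (v : T.V) : T.depth (T.parent v) = T.depth v - 1 := by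
  by_cases h : v = T.root
  · rw [h, T.parent_root, T.depth_root]
  · have := T.depth_parent v h
    omega

lemma depth_iterate_parent (k : ℕ) (v : T.V) :
    T.depth (T.parent^[k] v) = T.depth v - k := by
  induction k with
  | zero => simp
  | succ k ih => rw [Function.iterate_succ_apply', depth_parent_eq, ih]; omega

lemma depth_anc {v : T.V} {n : ℕ} (h : n ≤ T.depth v) : T.depth (T.anc v n) = n := by
  rw [anc, depth_iterate_parent]; omega

lemma anc_depth (v : T.V) : T.anc v (T.depth v) = v := by simp [anc]

lemma anc_zero (v : T.V) : T.anc v 0 = T.root := by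
  simpa [anc] using T.parent_iter_root v

lemma anc_anc {v : T.V} {n k : ℕ} (hnk : n ≤ k) (hk : k ≤ T.depth v) :
    T.anc (T.anc v k) n = T.anc v n := by
  have h : T.anc (T.anc v k) n = T.parent^[k - n] (T.anc v k) := by
    rw [anc, depth_anc T hk]
  rw [h, anc, ← Function.iterate_add_apply, anc]
  congr 1
  omega

lemma anc_parent {v : T.V} {n : ℕ} (h : n + 1 ≤ T.depth v) :
    T.anc (T.parent v) n = T.anc v n := by
  rw [anc, depth_parent_eq, ← Function.iterate_succ_apply, anc]
  congr 1
  omega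

lemma parent_anc {v : T.V} {n : ℕ} (h : n + 1 ≤ T.depth v) :
    T.parent (T.anc v (n + 1)) = T.anc v n := by
  rw [anc, anc, ← Function.iterate_succ_apply' T.parent]
  congr 1
  omega

lemma le_meetDepth_iff (x y : T.V) (n : ℕ) :
    n ≤ T.meetDepth x y ↔ n ≤ T.depth x ∧ n ≤ T.depth y ∧ T.anc x n = T.anc y n := by
  set S : Set ℕ := {n | n ≤ min (T.depth x) (T.depth y) ∧ T.anc x n = T.anc y n} with hS
  have hbdd : BddAbove S := ⟨min (T.depth x) (T.depth y), fun n hn => hn.1⟩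
  have hne : S.Nonempty := ⟨0, by simp, by rw [anc_zero, anc_zero]⟩
  constructor
  · intro h
    obtain ⟨h1, h2⟩ : T.meetDepth x y ∈ S := Nat.sSup_mem hne hbdd
    refine ⟨by omega, by omega, ?_⟩
    rw [← anc_anc T h (by omega : _ ≤ T.depth x), h2, anc_anc T h (by omega)]
  · rintro ⟨h1, h2, h3⟩
    exact le_csSup hbdd ⟨le_min h1 h2, h3⟩

lemma meetDepth_le_left (x y : T.V) : T.meetDepth x y ≤ T.depth x :=
  ((le_meetDepth_iff T x y _).1 le_rfl).1

lemma meetDepth_le_right (x y : T.V) : T.meetDepth x y ≤ T.depth y :=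
  ((le_meetDepth_iff T x y _).1 le_rfl).2.1

lemma meetDepth_comm (x y : T.V) : T.meetDepth x y = T.meetDepth y x := by
  refine eq_of_forall_le_iff fun n => ?_
  rw [le_meetDepth_iff, le_meetDepth_iff]
  exact ⟨fun h => ⟨h.2.1, h.1, h.2.2.symm⟩, fun h => ⟨h.2.1, h.1, h.2.2.symm⟩⟩

lemma meetDepth_ultra (x y z : T.V) :
    min (T.meetDepth x y) (T.meetDepth y z) ≤ T.meetDepth x z := by
  rw [le_meetDepth_iff]
  have h1 := (le_meetDepth_iff T x y _).1 (min_le_left _ (T.meetDepth y z))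
  have h2 := (le_meetDepth_iff T y z _).1 (min_le_right (T.meetDepth x y) _)
  exact ⟨h1.1, h2.2.1, h1.2.2.trans h2.2.2⟩

lemma meetDepth_anc {v : T.V} {n : ℕ} (h : n ≤ T.depth v) :
    T.meetDepth (T.anc v n) v = n := by
  apply le_antisymm
  · simpa [depth_anc T h] using meetDepth_le_left T (T.anc v n) v
  · rw [le_meetDepth_iff, depth_anc T h]
    exact ⟨le_rfl, h, anc_anc T le_rfl h⟩

lemma meetDepth_parent (v : T.V) : T.meetDepth (T.parent v) v = T.depth (T.parent v) := by
  apply le_antisymm (meetDepth_le_left T _ _)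
  rw [le_meetDepth_iff]
  refine ⟨le_rfl, by rw [depth_parent_eq]; omega, ?_⟩
  by_cases h : v = T.root
  · rw [h, T.parent_root]
  · exact anc_parent T (T.depth_parent v h).ge

lemma vdist_comm (x y : T.V) : T.vdist x y = T.vdist y x := by
  rw [vdist, vdist, meetDepth_comm, add_comm]

lemma vdist_eq_zero {x y : T.V} : T.vdist x y = 0 ↔ x = y := by
  have h1 := (le_meetDepth_iff T x y _).1 le_rfl
  constructor
  · intro h
    rw [vdist] at h
    have hx : T.meetDepth x y = T.depth x := by omega
    have hy : T.meetDepth x y = T.depth y := by omega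
    have h2 := h1.2.2
    rw [hx, anc_depth, ← hx, hy, anc_depth] at h2
    exact h2
  · rintro rfl
    have : T.depth x ≤ T.meetDepth x x := by rw [le_meetDepth_iff]; simp
    rw [vdist]
    omega

lemma vdist_self (x : T.V) : T.vdist x x = 0 := (vdist_eq_zero T).2 rfl

lemma vdist_pos {x y : T.V} (h : x ≠ y) : 0 < T.vdist x y :=
  Nat.pos_of_ne_zero fun h0 => h ((vdist_eq_zero T).1 h0)

lemma vdist_add_two_mul_meetDepth (x y : T.V) :
    T.vdist x y + 2 * T.meetDepth x y = T.depth x + T.depth y := by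
  have := meetDepth_le_left T x y
  have := meetDepth_le_right T x y
  rw [vdist]
  omega

/-- The four-point condition: a tree is a `0`-hyperbolic metric space. -/
lemma vdist_four_point (a b c e : T.V) :
    T.vdist a b + T.vdist c e ≤ T.vdist a c + T.vdist b e ∨
      T.vdist a b + T.vdist c e ≤ T.vdist a e + T.vdist b c := by
  have hab := vdist_add_two_mul_meetDepth T a b
  have hce := vdist_add_two_mul_meetDepth T c e
  have hac := vdist_add_two_mul_meetDepth T a c
  have hbe := vdist_add_two_mul_meetDepth T b e
  have hae := vdist_add_two_mul_meetDepth T a e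
  have hbc := vdist_add_two_mul_meetDepth T b c
  have h1 := meetDepth_ultra T a c b
  have h2 := meetDepth_ultra T a e b
  have h3 := meetDepth_ultra T c a e
  have h4 := meetDepth_ultra T c b e
  simp only [meetDepth_comm T c a, meetDepth_comm T c b, meetDepth_comm T e b,
    min_le_iff] at h1 h2 h3 h4
  omega

lemma vdist_triangle (a b c : T.V) : T.vdist a c ≤ T.vdist a b + T.vdist b c := by
  have h := vdist_four_point T a c b b
  rw [vdist_self, vdist_comm T c b] at h
  omega

/-- The perimeter of a triangle in a tree is even. -/
lemma even_perimeter (a b c : T.V) :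
    (T.vdist a b + T.vdist b c + T.vdist a c) % 2 = 0 := by
  have := vdist_add_two_mul_meetDepth T a b
  have := vdist_add_two_mul_meetDepth T b c
  have := vdist_add_two_mul_meetDepth T a c
  omega

lemma vdist_parent {v : T.V} (h : v ≠ T.root) : T.vdist (T.parent v) v = 1 := by
  have h1 := T.depth_parent v h
  rw [vdist, meetDepth_parent]
  omega

lemma parent_of_vdist_eq_one {x y : T.V} (h : T.vdist x y = 1) :
    T.parent x = y ∨ T.parent y = x := by
  have key : ∀ a b : T.V, T.meetDepth a b = T.depth a → T.depth b = T.depth a + 1 →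
      T.parent b = a := by
    intro a b h1 h2
    have h3 := (le_meetDepth_iff T a b _).1 h1.ge
    have h4 := h3.2.2
    rw [anc_depth] at h4
    rw [h4, anc, h2, Nat.add_sub_cancel_left, Function.iterate_one]
  have h1 := meetDepth_le_left T x y
  have h2 := meetDepth_le_right T x y
  rw [vdist] at h
  by_cases hx : T.meetDepth x y = T.depth x
  · exact Or.inr (key x y hx (by omega))
  · exact Or.inl (key y x (by rw [meetDepth_comm]; omega) (by omega))

lemma exists_step_towards {x y : T.V} (h : x ≠ y) :
    ∃ c, T.vdist x c = 1 ∧ T.vdist c y + 1 = T.vdist x y := by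
  have h1 := meetDepth_le_left T x y
  have h2 := meetDepth_le_right T x y
  have hd := vdist_add_two_mul_meetDepth T x y
  by_cases hx : T.meetDepth x y = T.depth x
  · have hlt : T.depth x + 1 ≤ T.depth y := by
      have := vdist_pos T h
      omega
    have hxy := ((le_meetDepth_iff T x y _).1 hx.ge).2.2
    rw [anc_depth] at hxy
    have hp : T.parent (T.anc y (T.depth x + 1)) = x := by rw [parent_anc T hlt, ← hxy]
    have hdc := depth_anc T hlt
    refine ⟨T.anc y (T.depth x + 1), ?_, ?_⟩
    · have := vdist_parent T (v := T.anc y (T.depth x + 1)) (by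
        intro h0
        rw [h0, T.depth_root] at hdc
        omega)
      rwa [hp] at this
    · have := vdist_add_two_mul_meetDepth T (T.anc y (T.depth x + 1)) y
      rw [meetDepth_anc T hlt] at this
      omega
  · have hr : x ≠ T.root := by
      rintro rfl
      rw [T.depth_root] at h1 hx
      omega
    refine ⟨T.parent x, by rw [vdist_comm]; exact vdist_parent T hr, ?_⟩
    have h3 := T.depth_parent x hr
    have h4 := meetDepth_parent T x
    have h5 := meetDepth_ultra T (T.parent x) x y
    have h6 := meetDepth_ultra T x (T.parent x) y
    have h7 := vdist_add_two_mul_meetDepth T (T.parent x) y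
    have h8 := meetDepth_le_left T (T.parent x) y
    rw [meetDepth_comm T x (T.parent x)] at h6
    simp only [min_le_iff] at h5 h6
    omega

variable {T}

lemma vdist_eq_two {a b c : T.V} (hab : T.vdist a b = 1) (hbc : T.vdist b c = 1)
    (hac : a ≠ c) : T.vdist a c = 2 := by
  have := vdist_triangle T a b c
  have := vdist_pos T hac
  have := even_perimeter T a b c
  omega

/-- Two geodesics that overlap in a nontrivial segment `[p, b]` concatenate to a geodesic. -/
lemma vdist_add_of_overlap {a p b c : T.V} (h : T.vdist a p + T.vdist p b = T.vdist a b)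
    (hpb : p ≠ b) (h' : T.vdist p b + T.vdist b c = T.vdist p c) :
    T.vdist a b + T.vdist b c = T.vdist a c := by
  have := vdist_four_point T a b p c
  have := vdist_triangle T a b c
  have := vdist_pos T hpb
  have := vdist_comm T b p
  omega

lemma vdist_of_nonbacktracking {r : ℕ → T.V} (h1 : ∀ n, T.vdist (r n) (r (n + 1)) = 1)
    (h2 : ∀ n, r n ≠ r (n + 2)) (i k : ℕ) : T.vdist (r i) (r (i + k)) = k := by
  have key : ∀ k, T.vdist (r i) (r (i + k)) = k ∧
      T.vdist (r i) (r (i + (k + 1))) = k + 1 := by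
    intro k
    induction k with
    | zero => exact ⟨vdist_self T _, h1 i⟩
    | succ k ih =>
      refine ⟨ih.2, ?_⟩
      have e1 := h1 (i + k)
      have e2 := h1 (i + (k + 1))
      have e3 := vdist_eq_two e1 e2 (h2 (i + k))
      have e4 : r (i + k) ≠ r (i + (k + 1)) := by
        intro h
        have := (vdist_eq_zero T).2 h
        have := h1 (i + k)
        simp only [add_assoc] at *
        omega
      have := vdist_add_of_overlap (a := r (i + 0)) (c := r (i + (k + 1 + 1)))
        (p := r (i + k)) (b := r (i + (k + 1)))
      simp only [add_assoc, add_zero] at *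
      have := this (by omega) e4 (by omega)
      omega
  exact (key k).1

lemma vdist_of_nonbacktracking_int {γ : ℤ → T.V}
    (h1 : ∀ n, T.vdist (γ n) (γ (n + 1)) = 1) (h2 : ∀ n, γ n ≠ γ (n + 2)) (i j : ℤ) :
    T.vdist (γ i) (γ j) = (j - i).natAbs := by
  have key : ∀ (i : ℤ) (k : ℕ), T.vdist (γ i) (γ (i + k)) = k := by
    intro i k
    have := vdist_of_nonbacktracking (r := fun n : ℕ => γ (i + n))
      (fun n => by simpa [add_assoc] using h1 (i + n))
      (fun n => by simpa [add_assoc] using h2 (i + n)) 0 k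
    simpa using this
  rcases le_total i j with h | h
  · have := key i (j - i).natAbs
    rwa [show i + ((j - i).natAbs : ℤ) = j by omega] at this
  · have := key j (j - i).natAbs
    rwa [show j + ((j - i).natAbs : ℤ) = i by omega, vdist_comm] at this

lemma isGeodLine_iff {γ : ℤ → T.V} :
    T.IsGeodLine γ ↔ ∀ i j, T.vdist (γ i) (γ j) = (j - i).natAbs := by
  constructor
  · rintro ⟨hinj, hadj⟩
    refine vdist_of_nonbacktracking_int (fun n => ?_) (fun n h => ?_)
    · have hne : γ n ≠ γ (n + 1) := fun h => by have := hinj h; omega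
      rcases hadj n with h | h
      · rw [← h, vdist_comm]
        refine vdist_parent T fun h0 => hne ?_
        rw [← h, h0, T.parent_root]
      · rw [← h]
        refine vdist_parent T fun h0 => hne ?_
        rw [← h, h0, T.parent_root]
    · have := hinj h
      omega
  · intro h
    refine ⟨fun i j hij => ?_, fun n => parent_of_vdist_eq_one T ?_⟩
    · have := h i j
      rw [hij, vdist_self] at this
      omega
    · rw [h]
      omega

/-- Every vertex has at least two neighbours. -/
lemma TwoChildren.exists_neighbours (hT : T.TwoChildren) (v : T.V) :
    ∃ a b, a ≠ b ∧ T.vdist v a = 1 ∧ T.vdist v b = 1 := by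
  obtain ⟨a, b, hab, ha, hb, rfl, h⟩ := hT v
  exact ⟨a, b, hab, vdist_parent T ha, h ▸ vdist_parent T hb⟩

lemma TwoChildren.exists_neighbour_ne (hT : T.TwoChildren) (p v : T.V) :
    ∃ a, a ≠ p ∧ T.vdist v a = 1 := by
  obtain ⟨a, b, hab, ha, hb⟩ := hT.exists_neighbours v
  by_cases h : a = p
  · exact ⟨b, fun h' => hab (h.trans h'.symm), hb⟩
  · exact ⟨a, h, ha⟩

lemma TwoChildren.exists_ray (hT : T.TwoChildren) {p q : T.V} (hpq : T.vdist p q = 1) :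
    ∃ r : ℕ → T.V, r 0 = p ∧ r 1 = q ∧ (∀ n, T.vdist (r n) (r (n + 1)) = 1) ∧
      ∀ n, r n ≠ r (n + 2) := by
  choose f hf1 hf2 using hT.exists_neighbour_ne
  let s : ℕ → T.V × T.V := fun n => (fun a => (a.2, f a.1 a.2))^[n] (p, q)
  have hs : ∀ n, s (n + 1) = ((s n).2, f (s n).1 (s n).2) := fun n =>
    Function.iterate_succ_apply' _ _ _
  refine ⟨fun n => (s n).1, rfl, rfl, fun n => ?_, fun n => ?_⟩
  · cases n with
    | zero => exact hpq
    | succ n => simpa [hs] using hf2 _ _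
  · simpa [hs] using (hf1 _ _).symm

lemma TwoChildren.exists_ray_through (hT : T.TwoChildren) (k : ℕ) (x y : T.V)
    (hxy : T.vdist x y = k + 1) :
    ∃ r : ℕ → T.V, r 0 = x ∧ r (k + 1) = y ∧ (∀ n, T.vdist (r n) (r (n + 1)) = 1) ∧
      ∀ n, r n ≠ r (n + 2) := by
  induction k generalizing x with
  | zero => exact hT.exists_ray hxy
  | succ k ih =>
    obtain ⟨c, hxc, hcy⟩ := exists_step_towards T (x := x) (y := y) (by
      rintro rfl
      rw [vdist_self] at hxy
      omega)
    obtain ⟨r, h0, hk, h1, h2⟩ := ih c (by omega)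
    refine ⟨fun n => Nat.casesOn n x r, rfl, hk, fun n => ?_, fun n => ?_⟩
    · cases n with
      | zero => simpa [h0] using hxc
      | succ n => exact h1 n
    · cases n with
      | zero =>
        intro h
        have h : x = r 1 := h
        have := vdist_of_nonbacktracking h1 h2 1 k
        rw [← h, add_comm, hk] at this
        omega
      | succ n => exact h2 n

lemma TwoChildren.exists_line_of_ne (hT : T.TwoChildren) {x y : T.V} (hxy : x ≠ y) :
    ∃ γ : ℤ → T.V, T.IsGeodLine γ ∧ γ 0 = x ∧ γ (T.vdist x y) = y := by
  obtain ⟨k, hk⟩ := Nat.exists_eq_add_of_lt (vdist_pos T hxy)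
  rw [zero_add] at hk
  obtain ⟨r, hr0, hrk, hr1, hr2⟩ := hT.exists_ray_through k x y hk
  obtain ⟨e, her, hxe⟩ := hT.exists_neighbour_ne (r 1) x
  obtain ⟨s, hs0, hs1, hs, hs2⟩ := hT.exists_ray hxe
  let γ : ℤ → T.V := fun n => if 0 ≤ n then r n.toNat else s (-n).toNat
  have hpos : ∀ n : ℕ, γ n = r n := fun n => by simp [γ]
  have hneg : ∀ n : ℕ, γ (-n) = s n := fun n => by
    by_cases h : n = 0
    · simp [γ, h, hr0, hs0]
    · have : ¬ (0 : ℤ) ≤ -n := by omega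
      simp [γ, h]
  refine ⟨γ, isGeodLine_iff.2 (vdist_of_nonbacktracking_int (fun n => ?_) (fun n => ?_)),
    by simpa [hr0] using hpos 0, ?_⟩
  · rcases lt_or_ge n 0 with h | h
    · obtain ⟨m, rfl⟩ : ∃ m : ℕ, n = -((m + 1 : ℕ) : ℤ) := ⟨(-n - 1).toNat, by omega⟩
      rw [hneg, show -((m + 1 : ℕ) : ℤ) + 1 = -(m : ℤ) by push_cast; ring, hneg, vdist_comm]
      exact hs m
    · lift n to ℕ using h
      have := hpos (n + 1)
      push_cast at this
      rw [hpos, this]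
      exact hr1 n
  · rcases lt_or_ge n 0 with h | h
    · by_cases h' : n = -1
      · subst h'
        have e1 := hneg 1
        have e2 := hpos 1
        push_cast at e1 e2
        rw [e1, show (-1 : ℤ) + 2 = 1 by norm_num, e2, hs1]
        exact her
      · obtain ⟨m, rfl⟩ : ∃ m : ℕ, n = -((m + 2 : ℕ) : ℤ) := ⟨(-n - 2).toNat, by omega⟩
        rw [hneg, show -((m + 2 : ℕ) : ℤ) + 2 = -(m : ℤ) by push_cast; ring, hneg]
        exact (hs2 m).symm
    · lift n to ℕ using h
      have := hpos (n + 2)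
      push_cast at this
      rw [hpos, this]
      exact hr2 n
  · rw [hk]
    exact (hpos (k + 1)).trans hrk

lemma TwoChildren.exists_line (hT : T.TwoChildren) (x y : T.V) :
    ∃ γ : ℤ → T.V, T.IsGeodLine γ ∧ γ 0 = x ∧ γ (T.vdist x y) = y := by
  by_cases hxy : x = y
  · obtain ⟨a, hax, -⟩ := hT.exists_neighbour_ne x x
    obtain ⟨γ, h1, h2, -⟩ := hT.exists_line_of_ne hax.symm
    exact ⟨γ, h1, h2, by rw [← hxy, vdist_self]; exact h2⟩
  · exact hT.exists_line_of_ne hxy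

/-- Points of the geodesic segment `[x, y]`, parametrised by their distance to `x`. -/
lemma TwoChildren.exists_between (hT : T.TwoChildren) {x y : T.V} {n : ℕ}
    (hn : n ≤ T.vdist x y) : ∃ z, T.vdist x z = n ∧ T.vdist z y + n = T.vdist x y := by
  obtain ⟨γ, h1, h2, h3⟩ := hT.exists_line x y
  rw [isGeodLine_iff] at h1
  have e1 := h1 0 n
  have e2 := h1 n (T.vdist x y)
  rw [h2] at e1
  rw [h3] at e2
  exact ⟨γ n, by omega, by omega⟩

lemma TwoChildren.exists_line_of_between (hT : T.TwoChildren) {x z y : T.V}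
    (h : T.vdist x z + T.vdist z y = T.vdist x y) :
    ∃ γ : ℤ → T.V, T.IsGeodLine γ ∧ x ∈ range γ ∧ z ∈ range γ ∧ y ∈ range γ := by
  obtain ⟨γ, h1, h2, h3⟩ := hT.exists_line x y
  refine ⟨γ, h1, ⟨_, h2⟩, ⟨T.vdist x z, ?_⟩, ⟨_, h3⟩⟩
  rw [isGeodLine_iff] at h1
  have e1 := h1 0 (T.vdist x z)
  have e2 := h1 (T.vdist x z) (T.vdist x y)
  rw [h2] at e1
  rw [h3] at e2
  have := vdist_four_point T (γ (T.vdist x z)) z x y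
  rw [vdist_comm T _ x, vdist_comm T z x] at this
  rw [← vdist_eq_zero T]
  omega

lemma vdist_of_mem_line {γ : ℤ → T.V} (hγ : T.IsGeodLine γ) {a b c : T.V}
    (ha : a ∈ range γ) (hb : b ∈ range γ) (hc : c ∈ range γ) :
    T.vdist a b + T.vdist b c = T.vdist a c ∨ T.vdist b a + T.vdist a c = T.vdist b c ∨
      T.vdist a c + T.vdist c b = T.vdist a b := by
  obtain ⟨i, rfl⟩ := ha
  obtain ⟨j, rfl⟩ := hb
  obtain ⟨k, rfl⟩ := hc
  rw [isGeodLine_iff] at hγ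
  simp only [hγ]
  omega

/-- Three vertices of a tree have a median. -/
lemma TwoChildren.exists_median (hT : T.TwoChildren) (a b c : T.V) :
    ∃ m, T.vdist a m + T.vdist m b = T.vdist a b ∧ T.vdist a m + T.vdist m c = T.vdist a c ∧
      T.vdist b m + T.vdist m c = T.vdist b c := by
  have hpar := even_perimeter T a b c
  have t1 := vdist_triangle T a b c
  have t2 := vdist_triangle T a c b
  have t3 := vdist_triangle T b a c
  rw [vdist_comm T c b] at t2
  rw [vdist_comm T b a] at t3
  obtain ⟨m, h1, h2⟩ := hT.exists_between (x := a) (y := b)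
    (n := (T.vdist a b + T.vdist a c - T.vdist b c) / 2) (by omega)
  have h3 := vdist_four_point T m c a b
  have h4 := vdist_triangle T a m c
  have h5 := vdist_triangle T b m c
  rw [vdist_comm T m a, vdist_comm T c b, vdist_comm T c a] at h3
  rw [vdist_comm T b m] at h5
  refine ⟨m, by omega, by omega, ?_⟩
  rw [vdist_comm T b m]
  omega

/-- The vertices `a`, `b`, `c` lie in three different components of the complement of `v`. -/
structure IsTripod (v a b c : T.V) : Prop where
  ne_left : a ≠ v
  ne_mid : b ≠ v
  ne_right : c ≠ v
  left_mid : T.vdist a v + T.vdist v b = T.vdist a b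
  left_right : T.vdist a v + T.vdist v c = T.vdist a c
  mid_right : T.vdist b v + T.vdist v c = T.vdist b c

lemma IsTripod.not_mem_line {v a b c : T.V} (h : IsTripod v a b c) {γ : ℤ → T.V}
    (hγ : T.IsGeodLine γ) (ha : a ∈ range γ) (hb : b ∈ range γ) (hc : c ∈ range γ) :
    False := by
  have h1 := vdist_of_mem_line hγ ha hb hc
  have := vdist_pos T h.ne_left
  have := vdist_pos T h.ne_mid
  have := vdist_pos T h.ne_right
  have := h.left_mid
  have := h.left_right
  have := h.mid_right
  simp only [vdist_comm T v b, vdist_comm T b a, vdist_comm T v c, vdist_comm T c b] at *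
  omega

/-- Lying in the same component of the complement of `v` is transitive. -/
lemma vdist_add_or_vdist_add {v a b : T.V} (h : T.vdist a v + T.vdist v b = T.vdist a b)
    (w : T.V) : T.vdist w v + T.vdist v a = T.vdist w a ∨
      T.vdist w v + T.vdist v b = T.vdist w b := by
  have h1 := vdist_four_point T w v a b
  have h2 := vdist_triangle T w v a
  have h3 := vdist_triangle T w v b
  rw [vdist_comm T v a] at *
  omega

/-- The vertex `v` has at least three neighbours. -/
def HasThreeNeighbours (v : T.V) : Prop :=
  ∃ a b c, a ≠ b ∧ a ≠ c ∧ b ≠ c ∧ T.vdist v a = 1 ∧ T.vdist v b = 1 ∧ T.vdist v c = 1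

lemma TwoChildren.hasThreeNeighbours (hT : T.TwoChildren) {v : T.V} (hv : v ≠ T.root) :
    HasThreeNeighbours v := by
  obtain ⟨a, b, hab, ha, hb, hav, hbv⟩ := hT v
  have h1 := T.depth_parent v hv
  have h2 := T.depth_parent a ha
  have h3 := T.depth_parent b hb
  rw [hav] at h2
  rw [hbv] at h3
  refine ⟨T.parent v, a, b, ?_, ?_, hab, by rw [vdist_comm]; exact vdist_parent T hv,
    hav ▸ vdist_parent T ha, hbv ▸ vdist_parent T hb⟩
  · rintro h
    rw [h] at h1
    omega
  · rintro h
    rw [h] at h1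
    omega

lemma HasThreeNeighbours.exists_isTripod {v a b : T.V} (hv : HasThreeNeighbours v)
    (ha : a ≠ v) (hb : b ≠ v) (hab : T.vdist a v + T.vdist v b = T.vdist a b) :
    ∃ c, IsTripod v a b c := by
  obtain ⟨p, q, r, hpq, hpr, hqr, hp, hq, hr⟩ := hv
  have dpq := vdist_eq_two ((vdist_comm T p v).trans hp) hq hpq
  have dpr := vdist_eq_two ((vdist_comm T p v).trans hp) hr hpr
  have dqr := vdist_eq_two ((vdist_comm T q v).trans hq) hr hqr
  have key : ∀ c, T.vdist v c = 1 → T.vdist a v + T.vdist v c = T.vdist a c →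
      T.vdist b v + T.vdist v c = T.vdist b c → ∃ c, IsTripod v a b c := by
    intro c hc h1 h2
    refine ⟨c, ha, hb, ?_, hab, h1, h2⟩
    rintro rfl
    rw [vdist_self] at hc
    omega
  have epq : T.vdist p v + T.vdist v q = T.vdist p q := by rw [vdist_comm T p v]; omega
  have epr : T.vdist p v + T.vdist v r = T.vdist p r := by rw [vdist_comm T p v]; omega
  have eqr : T.vdist q v + T.vdist v r = T.vdist q r := by rw [vdist_comm T q v]; omega
  by_contra hno
  have kp := fun h1 h2 => hno (key p hp h1 h2)
  have kq := fun h1 h2 => hno (key q hq h1 h2)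
  have kr := fun h1 h2 => hno (key r hr h1 h2)
  rcases vdist_add_or_vdist_add epq a with h | h
  · have hb1 := (vdist_add_or_vdist_add epq b).resolve_left (kp h)
    have hb2 := (vdist_add_or_vdist_add epr b).resolve_left (kp h)
    exact (vdist_add_or_vdist_add eqr a).elim (fun hq => kq hq hb1) fun hr => kr hr hb2
  · have hb1 := (vdist_add_or_vdist_add epq b).resolve_right (kq h)
    have hb2 := (vdist_add_or_vdist_add eqr b).resolve_left (kq h)
    exact (vdist_add_or_vdist_add epr a).elim (fun hp => kp hp hb1) fun hr => kr hr hb2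

/-- A set of vertices meeting the descendants of every vertex meets every half-tree. -/
lemma TwoChildren.exists_mem_halfTree (hT : T.TwoChildren) {s : Set T.V}
    (hs : ∀ v, ∃ u ∈ s, T.strictDesc v u) {v n : T.V} (hvn : T.vdist v n = 1) :
    ∃ u ∈ s, u ≠ v ∧ T.vdist u n + T.vdist n v = T.vdist u v := by
  obtain ⟨c, hcv, hc0, hcn⟩ : ∃ c, c ≠ v ∧ c ≠ T.root ∧ T.parent c = n := by
    obtain ⟨a, b, hab, ha, hb, han, hbn⟩ := hT n
    by_cases h : a = v
    · exact ⟨b, fun h' => hab (h.trans h'.symm), hb, hbn⟩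
    · exact ⟨a, h, ha, han⟩
  obtain ⟨u, hu, hlt, hcu⟩ := hs c
  have dcn : T.vdist c n = 1 := by rw [vdist_comm, ← hcn]; exact vdist_parent T hc0
  have dnv : T.vdist n v = 1 := by rw [vdist_comm]; exact hvn
  have dcv := vdist_eq_two dcn dnv hcv
  have hmc : T.meetDepth c u = T.depth c := by
    have := meetDepth_anc T hlt.le
    rwa [hcu] at this
  have hdc := T.depth_parent c hc0
  have hmn : T.meetDepth n u = T.depth n := by
    apply le_antisymm (meetDepth_le_left T n u)
    have h1 := meetDepth_ultra T n c u
    have h2 := meetDepth_parent T c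
    rw [hcn] at h2 hdc
    rw [h2, hmc] at h1
    omega
  have e1 := vdist_add_two_mul_meetDepth T c u
  have e2 := vdist_add_two_mul_meetDepth T n u
  rw [hcn] at hdc
  have hne : c ≠ n := by
    rintro rfl
    omega
  rw [vdist_comm] at e1 e2
  have e3 : T.vdist u n + T.vdist n v = T.vdist u v :=
    vdist_add_of_overlap (p := c) (by omega) hne (by omega)
  refine ⟨u, hu, ?_, e3⟩
  rintro rfl
  rw [vdist_self] at e3
  omega

lemma HasThreeNeighbours.exists_isTripod_mem (hT : T.TwoChildren) {s : Set T.V}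
    (hs : ∀ v, ∃ u ∈ s, T.strictDesc v u) {v : T.V} (hv : HasThreeNeighbours v) :
    ∃ a ∈ s, ∃ b ∈ s, ∃ c ∈ s, IsTripod v a b c := by
  obtain ⟨p, q, r, hpq, hpr, hqr, hp, hq, hr⟩ := hv
  obtain ⟨a, has, hav, ha⟩ := hT.exists_mem_halfTree hs hp
  obtain ⟨b, hbs, hbv, hb⟩ := hT.exists_mem_halfTree hs hq
  obtain ⟨c, hcs, hcv, hc⟩ := hT.exists_mem_halfTree hs hr
  have key : ∀ {p q a b : T.V}, p ≠ q → T.vdist v p = 1 → T.vdist v q = 1 →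
      T.vdist a p + T.vdist p v = T.vdist a v → T.vdist b q + T.vdist q v = T.vdist b v →
      T.vdist a v + T.vdist v b = T.vdist a b := by
    intro p q a b hpq hp hq ha hb
    have hp' := (vdist_comm T p v).trans hp
    have hq' := (vdist_comm T q v).trans hq
    have dpq := vdist_eq_two hp' hq hpq
    have hpv : p ≠ v := by
      rintro rfl
      rw [vdist_self] at hp
      omega
    have hqv : q ≠ v := by
      rintro rfl
      rw [vdist_self] at hq
      omega
    have h1 : T.vdist a v + T.vdist v q = T.vdist a q :=
      vdist_add_of_overlap ha hpv (by omega)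
    have h2 := vdist_add_of_overlap (c := a) hb hqv (by
      rw [vdist_comm T v a, vdist_comm T q a, vdist_comm T q v]; omega)
    rw [vdist_comm T v b, vdist_comm T a b, vdist_comm T a v]
    omega
  exact ⟨a, has, b, hbs, c, hcs, hav, hbv, hcv, key hpq hp hq ha hb, key hpr hp hr ha hc,
    key hqr hq hr hb hc⟩

/-- The map `G` sends each geodesic line into a geodesic line. -/
def MapsLines {X Y : VTree} (G : X.V → Y.V) : Prop :=
  ∀ γ : ℤ → X.V, X.IsGeodLine γ →
    ∃ δ : ℤ → Y.V, Y.IsGeodLine δ ∧ Set.range (fun n => G (γ n)) ⊆ Set.range δ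

variable {X Y : VTree} {G : X.V → Y.V}

lemma MapsLines.exists_line (hG : MapsLines G) (hX : X.TwoChildren) {x z y : X.V}
    (h : X.vdist x z + X.vdist z y = X.vdist x y) :
    ∃ δ : ℤ → Y.V, Y.IsGeodLine δ ∧ G x ∈ range δ ∧ G z ∈ range δ ∧ G y ∈ range δ := by
  obtain ⟨γ, hγ, ⟨i, rfl⟩, ⟨j, rfl⟩, ⟨k, rfl⟩⟩ := hX.exists_line_of_between h
  obtain ⟨δ, hδ, hsub⟩ := hG γ hγ
  exact ⟨δ, hδ, hsub ⟨i, rfl⟩, hsub ⟨j, rfl⟩, hsub ⟨k, rfl⟩⟩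

/-- The centre of a tripod spanned by image points is the image of the median. -/
lemma MapsLines.exists_centre (hG : MapsLines G) (hX : X.TwoChildren) {v : Y.V} {a b c : X.V}
    (h : IsTripod v (G a) (G b) (G c)) :
    ∃ m, G m = v ∧ X.vdist a m + X.vdist m b = X.vdist a b := by
  obtain ⟨m, hab, hac, hbc⟩ := hX.exists_median a b c
  refine ⟨m, ?_, hab⟩
  by_contra hm
  have key : ∀ {p q : X.V}, G p ≠ v → G q ≠ v →
      Y.vdist (G p) v + Y.vdist v (G q) = Y.vdist (G p) (G q) →
      X.vdist p m + X.vdist m q = X.vdist p q →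
      Y.vdist (G m) v + Y.vdist v (G p) = Y.vdist (G m) (G p) →
      Y.vdist (G m) v + Y.vdist v (G q) = Y.vdist (G m) (G q) → False := by
    intro p q hp hq hpq hmpq h1 h2
    obtain ⟨δ, hδ, hpδ, hmδ, hqδ⟩ := hG.exists_line hX hmpq
    exact IsTripod.not_mem_line ⟨hm, hp, hq, h1, h2, hpq⟩ hδ hmδ hpδ hqδ
  have k1 := key h.ne_left h.ne_mid h.left_mid hab
  have k2 := key h.ne_left h.ne_right h.left_right hac
  have k3 := key h.ne_mid h.ne_right h.mid_right hbc
  have o1 := vdist_add_or_vdist_add h.left_mid (G m)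
  have o2 := vdist_add_or_vdist_add h.left_right (G m)
  have o3 := vdist_add_or_vdist_add h.mid_right (G m)
  tauto

lemma MapsLines.mem_range (hG : MapsLines G) (hX : X.TwoChildren) (hY : Y.TwoChildren)
    (hdens : ∀ y, ∃ x, Y.strictDesc y (G x)) {v : Y.V} (hv : HasThreeNeighbours v) :
    v ∈ range G := by
  obtain ⟨_, ⟨a, rfl⟩, _, ⟨b, rfl⟩, _, ⟨c, rfl⟩, h⟩ :=
    hv.exists_isTripod_mem hY (s := range G) (fun y => by simpa using hdens y)
  obtain ⟨m, hm, -⟩ := hG.exists_centre hX h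
  exact ⟨m, hm⟩

lemma MapsLines.between_of_between (hG : MapsLines G) (hX : X.TwoChildren)
    (hinj : Function.Injective G) (hsurj : Function.Surjective G) {a m b : X.V}
    (hv : HasThreeNeighbours (G m)) (ha : a ≠ m) (hb : b ≠ m)
    (h : Y.vdist (G a) (G m) + Y.vdist (G m) (G b) = Y.vdist (G a) (G b)) :
    X.vdist a m + X.vdist m b = X.vdist a b := by
  obtain ⟨c, hc⟩ := hv.exists_isTripod (hinj.ne ha) (hinj.ne hb) h
  obtain ⟨c, rfl⟩ := hsurj c
  obtain ⟨m', hm', h'⟩ := hG.exists_centre hX hc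
  rwa [hinj hm'] at h'

lemma MapsLines.vdist_eq_one (hG : MapsLines G) (hX : X.TwoChildren)
    (hinj : Function.Injective G) (hsurj : Function.Surjective G) {x y : X.V}
    (hx : HasThreeNeighbours (G x)) (hy : HasThreeNeighbours (G y))
    (h : Y.vdist (G x) (G y) = 1) : X.vdist x y = 1 := by
  have hxy : x ≠ y := by
    rintro rfl
    rw [vdist_self] at h
    omega
  have hpos := vdist_pos X hxy
  by_contra hne
  obtain ⟨z, hz1, hz2⟩ := hX.exists_between (x := x) (y := y) (n := 1) hpos
  have hzx : z ≠ x := by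
    rintro rfl
    rw [vdist_self] at hz1
    omega
  have hzy : z ≠ y := by
    rintro rfl
    omega
  obtain ⟨δ, hδ, hxδ, hzδ, hyδ⟩ :=
    hG.exists_line hX (x := x) (z := z) (y := y) (by omega)
  rcases vdist_of_mem_line hδ hxδ hzδ hyδ with h1 | h1 | h1
  · have := vdist_pos Y (hinj.ne hzx.symm)
    have := vdist_pos Y (hinj.ne hzy)
    omega
  · have := hG.between_of_between hX hinj hsurj hx hzx hxy.symm h1
    rw [vdist_comm X z x] at this
    omega
  · have := hG.between_of_between hX hinj hsurj hy hxy hzy h1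
    rw [vdist_comm X y z] at this
    omega

/-- If the root of `Y` has only two neighbours, the inverse of `G` still sends them to
neighbours of the root of `X`. -/
lemma MapsLines.vdist_root_eq_one (hG : MapsLines G) (hX : X.TwoChildren)
    (hY : Y.TwoChildren) (hinj : Function.Injective G) (hsurj : Function.Surjective G)
    (hroot : G X.root = Y.root) (hdeg : ¬ HasThreeNeighbours Y.root) {x : X.V}
    (h : Y.vdist Y.root (G x) = 1) : X.vdist X.root x = 1 := by
  have key : ∀ c, X.vdist X.root c = 1 → Y.vdist Y.root (G c) = 1 := by
    intro c hc
    have hc0 : X.root ≠ c := by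
      rintro rfl
      rw [vdist_self] at hc
      omega
    have hpos := vdist_pos Y (hinj.ne hc0)
    rw [hroot] at hpos
    by_contra hne
    obtain ⟨b, hb1, hb2⟩ := hY.exists_between (x := Y.root) (y := G c) (n := 1) hpos
    obtain ⟨b, rfl⟩ := hsurj b
    have hb0 : G b ≠ Y.root := by
      intro h0
      rw [h0, vdist_self] at hb1
      omega
    have hbr : X.root ≠ b := by
      rintro rfl
      exact hb0 hroot
    have hcb : c ≠ b := by
      rintro rfl
      omega
    have := hG.between_of_between hX hinj hsurj (hY.hasThreeNeighbours hb0) hbr hcb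
      (by rw [hroot]; omega)
    have := vdist_pos X hbr
    have := vdist_pos X hcb.symm
    omega
  obtain ⟨c, e, hce, hc, he⟩ := hX.exists_neighbours X.root
  by_contra hx
  refine hdeg ⟨G c, G e, G x, hinj.ne hce, hinj.ne ?_, hinj.ne ?_, key c hc, key e he, h⟩
  · rintro rfl
    exact hx hc
  · rintro rfl
    exact hx he

end VTree

/-- Let X and Y be rooted trees in which each vertex has at least two
children. If G : X → Y is injective, maps geodesic lines into geodesic lines, has the
density property that below every vertex of Y there is a vertex in the image of G, and
either G maps root to root, or the root of Y has at least three children, then G is a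
surjective isometry for the graph distances. -/
theorem statement19 (X Y : VTree) (hX : X.TwoChildren) (hY : Y.TwoChildren)
    (G : X.V → Y.V)
    -- (i) G is injective
    (hinj : Function.Injective G)
    -- (ii) G maps geodesic lines into geodesic lines
    (hgeo : ∀ γ : ℤ → X.V, X.IsGeodLine γ →
      ∃ δ : ℤ → Y.V, Y.IsGeodLine δ ∧ Set.range (fun n => G (γ n)) ⊆ Set.range δ)
    -- (iii) density: below every vertex of Y there is an image point
    (hdens : ∀ y : Y.V, ∃ x : X.V, Y.strictDesc y (G x))
    -- (iv) G maps root to root, or the root of Y has at least three children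
    (hroot : G X.root = Y.root ∨
      ∃ w₁ w₂ w₃ : Y.V, w₁ ≠ w₂ ∧ w₁ ≠ w₃ ∧ w₂ ≠ w₃ ∧
        w₁ ≠ Y.root ∧ w₂ ≠ Y.root ∧ w₃ ≠ Y.root ∧
        Y.parent w₁ = Y.root ∧ Y.parent w₂ = Y.root ∧ Y.parent w₃ = Y.root) :
    (∀ x y : X.V, Y.vdist (G x) (G y) = X.vdist x y) ∧ Function.Surjective G := by
  have hG : VTree.MapsLines G := hgeo
  have hroot' : G X.root = Y.root ∨ VTree.HasThreeNeighbours Y.root := by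
    refine hroot.imp_right ?_
    rintro ⟨a, b, c, hab, hac, hbc, ha, hb, hc, pa, pb, pc⟩
    refine ⟨a, b, c, hab, hac, hbc, ?_, ?_, ?_⟩
    · exact pa ▸ VTree.vdist_parent Y ha
    · exact pb ▸ VTree.vdist_parent Y hb
    · exact pc ▸ VTree.vdist_parent Y hc
  have hsurj : Function.Surjective G := by
    intro y
    by_cases hy : y = Y.root
    · rcases hroot' with h | h
      · exact ⟨X.root, h.trans hy.symm⟩
      · exact hG.mem_range hX hY hdens (hy ▸ h)
    · exact hG.mem_range hX hY hdens (hY.hasThreeNeighbours hy)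
  have hadj : ∀ x y, Y.vdist (G x) (G y) = 1 → X.vdist x y = 1 := by
    intro x y h
    by_cases hdeg : VTree.HasThreeNeighbours Y.root
    · have hall : ∀ v : Y.V, VTree.HasThreeNeighbours v := by
        intro v
        by_cases hv : v = Y.root
        · exact hv ▸ hdeg
        · exact hY.hasThreeNeighbours hv
      exact hG.vdist_eq_one hX hinj hsurj (hall _) (hall _) h
    · have hr : G X.root = Y.root := hroot'.resolve_right hdeg
      by_cases hx : G x = Y.root
      · rw [hx] at h
        rw [hinj (hx.trans hr.symm)]
        exact hG.vdist_root_eq_one hX hY hinj hsurj hr hdeg h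
      by_cases hy : G y = Y.root
      · rw [hy, VTree.vdist_comm] at h
        rw [hinj (hy.trans hr.symm), VTree.vdist_comm]
        exact hG.vdist_root_eq_one hX hY hinj hsurj hr hdeg h
      exact hG.vdist_eq_one hX hinj hsurj (hY.hasThreeNeighbours hx)
        (hY.hasThreeNeighbours hy) h
  refine ⟨fun x y => ?_, hsurj⟩
  obtain ⟨δ, hδ, h0, h1⟩ := hY.exists_line (G x) (G y)
  choose γ hγ using fun n => hsurj (δ n)
  rw [VTree.isGeodLine_iff] at hδ
  have hd : ∀ i j, X.vdist (γ i) (γ j) = (j - i).natAbs := by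
    refine VTree.vdist_of_nonbacktracking_int (fun n => hadj _ _ ?_) (fun n hn => ?_)
    · rw [hγ, hγ, hδ]
      omega
    · have := hδ n (n + 2)
      rw [← hγ, ← hγ (n + 2), hn, VTree.vdist_self] at this
      omega
  have e0 : γ 0 = x := hinj ((hγ _).trans h0)
  have e1 : γ (Y.vdist (G x) (G y)) = y := hinj ((hγ _).trans h1)
  have := hd 0 (Y.vdist (G x) (G y))
  rw [e0, e1] at this
  omega
end
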